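/- If at some iteration the partition genuinely changes, then the palette strictly grows: for every n, if the relations C_n and C_{n+1} are not equal, then K_{n+1} ≥ K_n + 1. (Contrapositive form of Lemma 3, as used in the proof of the Theorem.) -/

import Mathlib

/-- Iterated color-refinement relation: `colRel V G 0` relates all pairs;
`colRel V G (n+1)` relates `v` and `w` iff for every vertex `u`, the number of
neighbors of `v` that are `colRel V G n`-related to `u` equals the number of
neighbors of `w` that are `colRel V G n`-related to `u`. -/
def colRel (V : Type*) (G : SimpleGraph V) : ℕ → V → V → Prop
  | 0 => fun _ _ => True
  | n + 1 => fun v w => ∀ u : V,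
      {x | G.Adj v x ∧ colRel V G n x u}.ncard =
      {x | G.Adj w x ∧ colRel V G n x u}.ncard

/-- `numClasses V G n` is the number of `colRel V G n`-equivalence classes. -/
noncomputable def numClasses (V : Type*) (G : SimpleGraph V) (n : ℕ) : ℕ :=
  {s : Set V | ∃ v : V, s = {w | colRel V G n v w}}.ncard

theorem colRel_equivalence (V : Type*) (G : SimpleGraph V) (n : ℕ) :
    Equivalence (colRel V G n) := by
  cases n with
  | zero => exact ⟨fun _ => trivial, fun _ => trivial, fun _ _ => trivial⟩
  | succ n =>
    exact ⟨fun _ _ => rfl, fun h u => (h u).symm, fun h k u => (h u).trans (k u)⟩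

theorem ncard_saturated {V : Type*} [Fintype V] (r : V → V → Prop) (hr : Equivalence r)
    (A B T : V → Prop) (hT : ∀ x y, r x y → T x → T y)
    (h : ∀ u, {x | A x ∧ r x u}.ncard = {x | B x ∧ r x u}.ncard) :
    {x | A x ∧ T x}.ncard = {x | B x ∧ T x}.ncard := by
  classical
  let s : Setoid V := ⟨r, hr⟩
  have key : ∀ A : V → Prop, {x | A x ∧ T x}.ncard =
      ∑ q : Quotient s, if T q.out then {x | A x ∧ r x q.out}.ncard else 0 := by
    intro A
    have e : ∀ P : V → Prop, {x | P x}.ncard = (Finset.univ.filter P).card := by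
      intro P
      rw [← Set.ncard_coe_finset]; simp
    rw [e, Finset.card_eq_sum_card_fiberwise (f := fun x => (Quotient.mk s x))
      (t := Finset.univ) (by intro x _; simp)]
    refine Finset.sum_congr rfl fun q _ => ?_
    have hq : ∀ x, Quotient.mk s x = q ↔ r x q.out := by
      intro x
      conv_lhs => rw [← Quotient.out_eq q]
      exact Quotient.eq
    split_ifs with hc
    · rw [e]
      congr 1
      ext x
      simp only [Finset.mem_filter, Finset.mem_univ, true_and, hq]
      constructor
      · rintro ⟨⟨a, _⟩, b⟩; exact ⟨a, b⟩
      · rintro ⟨a, b⟩; exact ⟨⟨a, hT _ _ (hr.symm b) hc⟩, b⟩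
    · rw [Finset.card_eq_zero]
      ext x
      simp only [Finset.mem_filter, Finset.mem_univ, true_and, hq, Finset.notMem_empty, iff_false]
      rintro ⟨⟨_, a⟩, b⟩
      exact hc (hT _ _ b a)
  rw [key A, key B]
  simp only [h]

theorem colRel_succ_le (V : Type*) [Fintype V] (G : SimpleGraph V) (n : ℕ) :
    ∀ v w, colRel V G (n + 1) v w → colRel V G n v w := by
  induction n with
  | zero => intro v w _; trivial
  | succ n ih =>
    intro v w h u
    exact ncard_saturated (colRel V G (n + 1)) (colRel_equivalence V G _) (G.Adj v) (G.Adj w)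
      (fun x => colRel V G n x u)
      (fun x y hxy hx => (colRel_equivalence V G n).trans
        ((colRel_equivalence V G n).symm (ih x y hxy)) hx) h

/-- Contrapositive of Lemma 3: if the partition genuinely changes, the palette strictly grows. -/
theorem numClasses_succ_ge_of_ne (V : Type*) [Fintype V] (G : SimpleGraph V) (n : ℕ)
    (h : colRel V G n ≠ colRel V G (n + 1)) :
    numClasses V G (n + 1) ≥ numClasses V G n + 1 := by
  have hE := colRel_equivalence V G
  have hle := colRel_succ_le V G n
  let f : ℕ → V → Set V := fun n v => {w | colRel V G n v w}
  have hf : ∀ n v w, f n v = f n w ↔ colRel V G n v w := by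
    intro n v w
    constructor
    · intro e
      have : w ∈ f n w := (hE n).refl w
      rw [← e] at this
      exact this
    · intro e
      ext x
      exact ⟨fun k => (hE n).trans ((hE n).symm e) k, fun k => (hE n).trans e k⟩
  have hN : ∀ n, numClasses V G n = (Set.range (f n)).ncard := by
    intro n
    unfold numClasses
    congr 1
    ext s
    exact ⟨fun ⟨v, e⟩ => ⟨v, e.symm⟩, fun ⟨v, e⟩ => ⟨v, e.symm⟩⟩
  let g : Set V → Set V := fun s => {w | ∃ v ∈ s, colRel V G n v w}
  have hg : ∀ v, g (f (n + 1) v) = f n v := by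
    intro v
    ext w
    constructor
    · rintro ⟨x, hx, k⟩
      exact (hE n).trans (hle _ _ hx) k
    · intro k
      exact ⟨v, (hE (n + 1)).refl v, k⟩
  have hr : Set.range (f n) = g '' Set.range (f (n + 1)) := by
    rw [← Set.range_comp]
    congr 1
    funext v
    exact (hg v).symm
  rw [hN, hN, hr]
  have hfin : (Set.range (f (n + 1))).Finite := Set.toFinite _
  refine lt_of_le_of_ne (Set.ncard_image_le hfin) fun e => h ?_
  have inj := (Set.ncard_image_iff hfin).1 e
  funext v w
  refine propext ⟨fun k => ?_, hle v w⟩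
  rw [← hf]
  apply inj ⟨v, rfl⟩ ⟨w, rfl⟩
  rw [hg, hg, hf]
  exact k
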